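/- Let Σ = {σ₁,…,σₙ} be a finite family of injective non-unital ring endomorphisms of a ring R, and suppose R is Σ-semicommutative and Baer. Then for every nonempty subset S of R and every α ∈ ℕⁿ, l_R(S) = l_R(σ^α(S)), where σ^α(S) = {σ^α(s) : s ∈ S}. -/

import Mathlib

/-- A non-unital ring endomorphism: an additive and multiplicative map
(not required to send `1` to `1`). -/
def IsNUEnd {R : Type*} [Ring R] (σ : R → R) : Prop :=
  (∀ a b : R, σ (a + b) = σ a + σ b) ∧ (∀ a b : R, σ (a * b) = σ a * σ b)

/-- For a family `σ : Fin n → R → R` and `α ∈ ℕⁿ`, the composition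
`σ₁^{α₁} ∘ ⋯ ∘ σₙ^{αₙ}`. -/
def famPow {R : Type*} {n : ℕ} (σ : Fin n → R → R) (α : Fin n → ℕ) : R → R :=
  (List.ofFn (fun i => (σ i)^[α i])).foldr (· ∘ ·) id

/-- `R` is `Σ`-semicommutative: `a * b = 0` implies `a * r * σ^α(b) = 0`
for every `r ∈ R` and every `α ≠ 0`. -/
def SigmaSemicomm {R : Type*} [Ring R] {n : ℕ} (σ : Fin n → R → R) : Prop :=
  ∀ a b : R, a * b = 0 → ∀ r : R, ∀ α : Fin n → ℕ, α ≠ 0 → a * r * famPow σ α b = 0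

/-- `R` is `σ`-semicommutative (single endomorphism). -/
def SingleSemicomm {R : Type*} [Ring R] (σ : R → R) : Prop :=
  ∀ a b : R, a * b = 0 → ∀ r : R, a * r * σ b = 0

/-- `R` is `Σ`-rigid: `a * σ^α(a) = 0` implies `a = 0`. -/
def SigmaRigid {R : Type*} [Ring R] {n : ℕ} (σ : Fin n → R → R) : Prop :=
  ∀ (a : R) (α : Fin n → ℕ), a * famPow σ α a = 0 → a = 0

/-- `δ` is a `σ`-derivation of `R`. -/
def IsSigmaDerivation {R : Type*} [Ring R] (σ δ : R → R) : Prop :=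
  (∀ a b : R, δ (a + b) = δ a + δ b) ∧
    (∀ a b : R, δ (a * b) = σ a * δ b + δ a * b)

/-- The left annihilator `l_R(S)` of a subset `S ⊆ R`. -/
def leftAnn {R : Type*} [Ring R] (S : Set R) : Set R :=
  {x : R | ∀ s ∈ S, x * s = 0}

/-- The right annihilator `r_R(S)` of a subset `S ⊆ R`. -/
def rightAnn {R : Type*} [Ring R] (S : Set R) : Set R :=
  {x : R | ∀ s ∈ S, s * x = 0}

/-- `R` is Baer (left annihilator version): the left annihilator of every
nonempty subset is of the form `Re` for an idempotent `e`. -/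
def IsBaerLeft (R : Type*) [Ring R] : Prop :=
  ∀ S : Set R, S.Nonempty →
    ∃ e : R, e * e = e ∧ leftAnn S = {x : R | ∃ r : R, x = r * e}

/-- `R` is Baer (right annihilator version): the right annihilator of every
nonempty subset is of the form `eR` for an idempotent `e`. -/
def IsBaerRight (R : Type*) [Ring R] : Prop :=
  ∀ S : Set R, S.Nonempty →
    ∃ e : R, e * e = e ∧ rightAnn S = {x : R | ∃ r : R, x = e * r}

/-- `R` is quasi-Baer: the right annihilator of every right ideal
(an additive subgroup closed under right multiplication) is of the form `eR`
for an idempotent `e`. -/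
def IsQuasiBaer (R : Type*) [Ring R] : Prop :=
  ∀ I : AddSubgroup R, (∀ a ∈ I, ∀ r : R, a * r ∈ I) →
    ∃ e : R, e * e = e ∧ rightAnn (I : Set R) = {x : R | ∃ r : R, x = e * r}

section

variable {R : Type*} [Ring R]

theorem IsNUEnd.id : IsNUEnd (id : R → R) := ⟨fun _ _ => rfl, fun _ _ => rfl⟩

theorem IsNUEnd.comp {f g : R → R} (hf : IsNUEnd f) (hg : IsNUEnd g) : IsNUEnd (f ∘ g) :=
  ⟨fun a b => by simp [hg.1, hf.1], fun a b => by simp [hg.2, hf.2]⟩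

theorem IsNUEnd.iterate {f : R → R} (hf : IsNUEnd f) : ∀ k : ℕ, IsNUEnd f^[k]
  | 0 => IsNUEnd.id
  | k + 1 => (hf.iterate k).comp hf

theorem IsNUEnd.map_zero {f : R → R} (hf : IsNUEnd f) : f 0 = 0 := by
  simpa using hf.1 0 0

theorem IsNUEnd.map_sub {f : R → R} (hf : IsNUEnd f) (a b : R) : f (a - b) = f a - f b := by
  rw [eq_sub_iff_add_eq, ← hf.1, sub_add_cancel]

theorem IsNUEnd.foldr_comp (l : List (R → R)) (hl : ∀ f ∈ l, IsNUEnd f) :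
    IsNUEnd (l.foldr (· ∘ ·) _root_.id) := by
  induction l with
  | nil => exact IsNUEnd.id
  | cons f l ih =>
    exact (hl f (by simp)).comp (ih fun g hg => hl g (by simp [hg]))

theorem injective_foldr_comp {X : Type*} (l : List (X → X))
    (hl : ∀ f ∈ l, Function.Injective f) :
    Function.Injective (l.foldr (· ∘ ·) id) := by
  induction l with
  | nil => exact Function.injective_id
  | cons f l ih =>
    exact (hl f (by simp)).comp (ih fun g hg => hl g (by simp [hg]))

theorem IsNUEnd.famPow {n : ℕ} {σ : Fin n → R → R} (hσ : ∀ i, IsNUEnd (σ i))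
    (α : Fin n → ℕ) : IsNUEnd (famPow σ α) := by
  refine IsNUEnd.foldr_comp _ fun f hf => ?_
  obtain ⟨i, rfl⟩ := List.mem_ofFn.1 hf
  exact (hσ i).iterate _

theorem famPow_injective {X : Type*} {n : ℕ} {σ : Fin n → X → X}
    (hinj : ∀ i, Function.Injective (σ i)) (α : Fin n → ℕ) :
    Function.Injective (famPow σ α) := by
  refine injective_foldr_comp _ fun f hf => ?_
  obtain ⟨i, rfl⟩ := List.mem_ofFn.1 hf
  exact (hinj i).iterate _

theorem famPow_zero {X : Type*} {n : ℕ} (σ : Fin n → X → X) :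
    famPow σ 0 = id := by
  unfold famPow
  induction n with
  | zero => simp
  | succ n ih => simpa using ih fun i => σ i.succ

theorem SingleSemicomm.map_one {τ : R → R} (hsc : SingleSemicomm τ) (hτ : IsNUEnd τ)
    (hinj : Function.Injective τ) : τ 1 = 1 := by
  have hidem : τ 1 * τ 1 = τ 1 := by rw [← hτ.2, one_mul]
  have h := hsc (τ 1) (1 - τ 1) (by rw [mul_sub, mul_one, hidem, sub_self]) 1
  rw [mul_one, hτ.map_sub, mul_sub, hidem, ← hτ.2, one_mul, sub_eq_zero] at h
  exact (hinj h).symm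

theorem SingleSemicomm.map_idempotent {τ : R → R} (hsc : SingleSemicomm τ) (hτ : IsNUEnd τ)
    (hinj : Function.Injective τ) {e : R} (he : e * e = e) : τ e = e := by
  have h₁ := hsc e (1 - e) (by rw [mul_sub, mul_one, he, sub_self]) 1
  have h₂ := hsc (1 - e) e (by rw [sub_mul, one_mul, he, sub_self]) 1
  rw [mul_one, hτ.map_sub, hsc.map_one hτ hinj, mul_sub, mul_one, sub_eq_zero] at h₁
  rw [mul_one, sub_mul, one_mul, sub_eq_zero] at h₂
  exact h₂.trans h₁.symm

theorem SingleSemicomm.leftAnn_image {τ : R → R} (hsc : SingleSemicomm τ) (hτ : IsNUEnd τ)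
    (hinj : Function.Injective τ) (hB : IsBaerLeft R) {S : Set R} (hS : S.Nonempty) :
    leftAnn S = leftAnn (τ '' S) := by
  ext x
  constructor
  · rintro hx _ ⟨s, hs, rfl⟩
    simpa using hsc x s (hx s hs) 1
  · intro hx s hs
    obtain ⟨e, he, hann⟩ := hB (τ '' S) (hS.image τ)
    have hmem : e ∈ leftAnn (τ '' S) := by
      rw [hann]
      exact ⟨1, (one_mul e).symm⟩
    rw [hann] at hx
    obtain ⟨r, rfl⟩ := hx
    have hes : e * s = 0 := hinj <| by
      rw [hτ.2, hsc.map_idempotent hτ hinj he, hτ.map_zero]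
      exact hmem _ ⟨s, hs, rfl⟩
    rw [mul_assoc, hes, mul_zero]

end

/-- in a `Σ`-semicommutative Baer ring,
`l_R(S) = l_R(σ^α(S))` for every nonempty `S` and every `α`. -/
theorem sigma_semicomm_baer_leftAnn_eq {R : Type*} [Ring R] {n : ℕ}
    (σ : Fin n → R → R) (hσ : ∀ i, IsNUEnd (σ i))
    (hinj : ∀ i, Function.Injective (σ i))
    (hsc : SigmaSemicomm σ) (hB : IsBaerLeft R) :
    ∀ S : Set R, S.Nonempty → ∀ α : Fin n → ℕ,
      leftAnn S = leftAnn (famPow σ α '' S) := by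
  intro S hS α
  rcases eq_or_ne α 0 with rfl | hα
  · rw [famPow_zero, Set.image_id]
  · have hτ : SingleSemicomm (famPow σ α) := fun a b hab r => hsc a b hab r α hα
    exact hτ.leftAnn_image (IsNUEnd.famPow hσ α) (famPow_injective hinj α) hB hS
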